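/- Lipschitz continuity of the gradient map: if ∇d is Lipschitz in the sense that ‖∇d(λ) − ∇d(λ̃)‖_{W⁻¹} ≤ ‖λ − λ̃‖_W for all λ, λ̃ ∈ 𝔻, then the gradient map ∇⁺d(λ) = [λ + W⁻¹∇d(λ)]^W_𝔻 − λ satisfies ‖∇⁺d(λ) − ∇⁺d(λ̃)‖_W ≤ 3 ‖λ − λ̃‖_W for all λ, λ̃ ∈ 𝔻. -/

import Mathlib

open Finset

/-- Euclidean norm of a finite-dimensional real vector. -/
noncomputable def enorm {ι : Type*} [Fintype ι] (x : ι → ℝ) : ℝ :=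
  Real.sqrt (∑ i, x i ^ 2)

/-- Weighted norm `‖x‖_W` for the diagonal positive definite matrix `W = diag w`. -/
noncomputable def wnorm {ι : Type*} [Fintype ι] (w x : ι → ℝ) : ℝ :=
  Real.sqrt (∑ i, w i * x i ^ 2)

/-- Weighted norm `‖x‖_{W⁻¹}` for the diagonal positive definite matrix `W = diag w`. -/
noncomputable def wnormInv {ι : Type*} [Fintype ι] (w x : ι → ℝ) : ℝ :=
  Real.sqrt (∑ i, x i ^ 2 / w i)

/-- Euclidean inner product. -/
def dotp {ι : Type*} [Fintype ι] (x y : ι → ℝ) : ℝ := ∑ i, x i * y i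

/-- Euclidean projection onto `𝔻 = ℝ^p × ℝ^q₊` (identity on the first block,
componentwise positive part on the second block).  Since the matrices `W` below are
diagonal, this coincides with the projection in the norm `‖·‖_W`. -/
def projD {p q : ℕ} (v : Fin p ⊕ Fin q → ℝ) : Fin p ⊕ Fin q → ℝ :=
  Sum.elim (fun i => v (Sum.inl i)) (fun j => max (v (Sum.inr j)) 0)

/-- Weighted norm `‖x‖_W = √(xᵀWx)` for a (not necessarily diagonal) matrix `W`. -/
noncomputable def wnormM {ι : Type*} [Fintype ι] (W : Matrix ι ι ℝ) (x : ι → ℝ) : ℝ :=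
  Real.sqrt (∑ i, x i * W.mulVec x i)

/-- The Cauchy–Schwarz inequality for a positive semidefinite bilinear form. -/
theorem apply_le_sqrt_mul_sqrt {E : Type*} [AddCommGroup E] [Module ℝ E]
    (B : LinearMap.BilinForm ℝ E) (hs : ∀ x, 0 ≤ B x x) (hB : ∀ x y, B x y = B y x) (x y : E) :
    B x y ≤ √(B x x) * √(B y y) := by
  rw [← Real.sqrt_mul (hs x)]
  refine Real.le_sqrt_of_sq_le ?_
  have h := LinearMap.BilinForm.apply_mul_apply_le_of_forall_zero_le B hs x y
  rwa [hB y x, ← sq] at h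

/-- The triangle inequality for a positive semidefinite form. -/
theorem sqrt_apply_add_le {E : Type*} [AddCommGroup E] [Module ℝ E]
    (B : LinearMap.BilinForm ℝ E) (hs : ∀ x, 0 ≤ B x x) (hB : ∀ x y, B x y = B y x) (x y : E) :
    √(B (x + y) (x + y)) ≤ √(B x x) + √(B y y) := by
  have hcs := apply_le_sqrt_mul_sqrt B hs hB x y
  refine Real.sqrt_le_iff.mpr ⟨by positivity, ?_⟩
  have hx := Real.sq_sqrt (hs x)
  have hy := Real.sq_sqrt (hs y)
  simp only [map_add, LinearMap.add_apply, hB y x]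
  nlinarith

/-- The variational inequality characterizing a nearest point of a convex set. -/
theorem apply_sub_sub_nonneg_of_forall_le {E : Type*} [AddCommGroup E] [Module ℝ E]
    (B : LinearMap.BilinForm ℝ E) (hB : ∀ x y, B x y = B y x) {C : Set E} (hC : Convex ℝ C)
    {v z y : E} (hz : z ∈ C) (hmin : ∀ x ∈ C, B (z - v) (z - v) ≤ B (x - v) (x - v))
    (hy : y ∈ C) : 0 ≤ B (z - v) (y - z) := by
  by_contra! hneg
  have key : ∀ t : ℝ, 0 < t → t ≤ 1 → 0 ≤ 2 * B (z - v) (y - z) + t * B (y - z) (y - z) := by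
    intro t ht ht1
    have h := hmin _ (hC.add_smul_sub_mem hz hy ⟨ht.le, ht1⟩)
    have e : z + t • (y - z) - v = (z - v) + t • (y - z) := by abel
    rw [e] at h
    generalize z - v = a at *
    generalize y - z = b at *
    simp only [map_add, LinearMap.add_apply, map_smul, LinearMap.smul_apply, smul_eq_mul,
      hB b a] at h
    refine nonneg_of_mul_nonneg_right (a := t) ?_ ht
    linarith
  set b := B (z - v) (y - z)
  set c := B (y - z) (y - z)
  have h1 := key 1 one_pos le_rfl
  have hc : 0 < c := by linarith
  have h2 := key (-b / c) (div_pos (by linarith) hc) ((div_le_one hc).mpr (by linarith))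
  rw [div_mul_cancel₀ _ hc.ne'] at h2
  linarith

/-- Projections onto a convex set are nonexpansive. -/
theorem sqrt_apply_sub_le_of_nearest {E : Type*} [AddCommGroup E] [Module ℝ E]
    (B : LinearMap.BilinForm ℝ E) (hs : ∀ x, 0 ≤ B x x) (hB : ∀ x y, B x y = B y x)
    {C : Set E} (hC : Convex ℝ C) {u v y z : E} (hy : y ∈ C) (hz : z ∈ C)
    (hyu : ∀ x ∈ C, B (y - u) (y - u) ≤ B (x - u) (x - u))
    (hzv : ∀ x ∈ C, B (z - v) (z - v) ≤ B (x - v) (x - v)) :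
    √(B (y - z) (y - z)) ≤ √(B (u - v) (u - v)) := by
  have h1 := apply_sub_sub_nonneg_of_forall_le B hB hC hy hyu hz
  have h2 := apply_sub_sub_nonneg_of_forall_le B hB hC hz hzv hy
  have h3 : B (y - z) (y - z) ≤ B (u - v) (y - z) := by
    simp only [map_sub, LinearMap.sub_apply] at h1 h2 ⊢
    linarith
  have h4 := apply_le_sqrt_mul_sqrt B hs hB (u - v) (y - z)
  have h5 := Real.mul_self_sqrt (hs (y - z))
  by_contra! hlt
  have h6 : 0 < √(B (y - z) (y - z)) := (Real.sqrt_nonneg _).trans_lt hlt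
  nlinarith

theorem wnormM_eq_sqrt_toBilin' {ι : Type*} [Fintype ι] [DecidableEq ι] (W : Matrix ι ι ℝ)
    (x : ι → ℝ) : wnormM W x = √(Matrix.toBilin' W x x) := by
  rw [Matrix.toBilin'_apply']
  rfl

theorem wnormM_inv_mulVec {ι : Type*} [Fintype ι] [DecidableEq ι] {W : Matrix ι ι ℝ}
    (hW : IsUnit W.det) (g : ι → ℝ) : wnormM W (W⁻¹.mulVec g) = wnormM W⁻¹ g := by
  simp [wnormM, Matrix.mulVec_mulVec, Matrix.mul_nonsing_inv W hW, mul_comm]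

theorem convex_setOf_inr_nonneg {α β : Type*} :
    Convex ℝ {x : α ⊕ β → ℝ | ∀ j, 0 ≤ x (Sum.inr j)} := by
  intro x hx y hy a b ha hb _ j
  exact add_nonneg (mul_nonneg ha (hx j)) (mul_nonneg hb (hy j))

/-- Lipschitz continuity of the gradient map: if `∇d` is Lipschitz in
the sense that `‖∇d(λ) - ∇d(λ̃)‖_{W⁻¹} ≤ ‖λ - λ̃‖_W` for all `λ, λ̃ ∈ 𝔻`, then the gradient
map `∇⁺d(λ) = [λ + W⁻¹∇d(λ)]^W_𝔻 - λ` satisfies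
`‖∇⁺d(λ) - ∇⁺d(λ̃)‖_W ≤ 3‖λ - λ̃‖_W` for all `λ, λ̃ ∈ 𝔻`. -/
theorem stmt18
    {p q : ℕ}
    (d : (Fin p ⊕ Fin q → ℝ) → ℝ)
    (grad : (Fin p ⊕ Fin q → ℝ) → Fin p ⊕ Fin q → ℝ)
    (hconc : ∀ a b : Fin p ⊕ Fin q → ℝ, d b ≤ d a + dotp (grad a) (b - a))
    (W : Matrix (Fin p ⊕ Fin q) (Fin p ⊕ Fin q) ℝ) (hW : W.PosDef)
    (hLip : ∀ a b : Fin p ⊕ Fin q → ℝ,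
        wnormM W⁻¹ (grad a - grad b) ≤ wnormM W (a - b))
    -- `projW v = [v]^W_𝔻` is the projection onto `𝔻 = ℝ^p × ℝ^q₊` w.r.t. `‖·‖_W`:
    (projW : (Fin p ⊕ Fin q → ℝ) → Fin p ⊕ Fin q → ℝ)
    (hprojW : ∀ v : Fin p ⊕ Fin q → ℝ, (∀ j, 0 ≤ projW v (Sum.inr j))
        ∧ ∀ xi : Fin p ⊕ Fin q → ℝ, (∀ j, 0 ≤ xi (Sum.inr j)) →
            wnormM W (projW v - v) ≤ wnormM W (xi - v))
    : ∀ lam lam' : Fin p ⊕ Fin q → ℝ,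
      (∀ j, 0 ≤ lam (Sum.inr j)) → (∀ j, 0 ≤ lam' (Sum.inr j)) →
      wnormM W ((projW (lam + W⁻¹.mulVec (grad lam)) - lam)
          - (projW (lam' + W⁻¹.mulVec (grad lam')) - lam'))
        ≤ 3 * wnormM W (lam - lam') := by
  intro lam lam' _ _
  set B := Matrix.toBilin' W with hBdef
  have hs : ∀ x, 0 ≤ B x x := fun x => by
    rw [hBdef, Matrix.toBilin'_apply']
    simpa using hW.posSemidef.dotProduct_mulVec_nonneg x
  have hWt : W.transpose = W := by simpa using hW.isHermitian.eq
  have hB : ∀ x y, B x y = B y x := fun x y => by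
    rw [hBdef, Matrix.toBilin'_apply', Matrix.toBilin'_apply', Matrix.dotProduct_mulVec,
      ← Matrix.mulVec_transpose, hWt, dotProduct_comm]
  have hdet : IsUnit W.det := hW.det_pos.ne'.isUnit
  have htri : ∀ x y, wnormM W (x + y) ≤ wnormM W x + wnormM W y := fun x y => by
    simpa only [wnormM_eq_sqrt_toBilin'] using sqrt_apply_add_le B hs hB x y
  have hmin : ∀ v, ∀ x ∈ {x : Fin p ⊕ Fin q → ℝ | ∀ j, 0 ≤ x (Sum.inr j)},
      B (projW v - v) (projW v - v) ≤ B (x - v) (x - v) := fun v x hx => by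
    have h := (hprojW v).2 x hx
    rw [wnormM_eq_sqrt_toBilin', wnormM_eq_sqrt_toBilin'] at h
    exact (Real.sqrt_le_sqrt_iff (hs _)).mp h
  have hne : ∀ u v, wnormM W (projW u - projW v) ≤ wnormM W (u - v) := fun u v => by
    simpa only [wnormM_eq_sqrt_toBilin'] using
      sqrt_apply_sub_le_of_nearest B hs hB convex_setOf_inr_nonneg (hprojW u).1 (hprojW v).1
        (hmin u) (hmin v)
  have hneg : wnormM W (lam' - lam) = wnormM W (lam - lam') := by
    rw [← neg_sub lam lam', wnormM_eq_sqrt_toBilin', wnormM_eq_sqrt_toBilin', map_neg,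
      map_neg, LinearMap.neg_apply, neg_neg]
  set u := lam + W⁻¹.mulVec (grad lam) with hu
  set v := lam' + W⁻¹.mulVec (grad lam') with hv
  have huv : u - v = (lam - lam') + W⁻¹.mulVec (grad lam - grad lam') := by
    rw [hu, hv, Matrix.mulVec_sub]
    abel
  have hstep : wnormM W (u - v) ≤ 2 * wnormM W (lam - lam') := by
    have h := htri (lam - lam') (W⁻¹.mulVec (grad lam - grad lam'))
    rw [wnormM_inv_mulVec hdet, ← huv] at h
    linarith [hLip lam lam']
  have hsplit : projW u - lam - (projW v - lam') = (projW u - projW v) + (lam' - lam) := by abel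
  rw [hsplit]
  linarith [htri (projW u - projW v) (lam' - lam), hne u v]
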